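/- For every constant ε > 0 there exist a constant c > 0, a family of constant-indegree DAGs {G_N} with at most c·N nodes, and target sets V_C ⊆ V(G_N) with |V_C| = N, such that the pair (G_N, V_C) is (s, N^{1−ε}, s/N)-hard for every s ≤ N. -/

import Mathlib

/-! ## Basic digraph notions -/

/-- A directed path in a digraph `Adj`: a nonempty list of vertices, each
consecutive pair joined by a directed edge.  Its length (number of edges)
is `p.length - 1`, so a path "of length d" is a list with `p.length = d + 1`. -/
def PathIn {V : Type*} (Adj : V → V → Prop) (p : List V) : Prop :=
  p ≠ [] ∧ p.Chain' Adj

/-- A digraph is acyclic (is a DAG) if it has no directed cycle. -/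
def Acyclic {V : Type*} (Adj : V → V → Prop) : Prop :=
  ∀ v, ¬ Relation.TransGen Adj v v

/-- In-degree of a vertex. -/
noncomputable def indeg {V : Type*} (Adj : V → V → Prop) (v : V) : ℕ :=
  Nat.card {u // Adj u v}

/-- Out-degree of a vertex. -/
noncomputable def outdeg {V : Type*} (Adj : V → V → Prop) (v : V) : ℕ :=
  Nat.card {w // Adj v w}

/-- `δ(v) = max(indeg(v), outdeg(v))`. -/
noncomputable def delta {V : Type*} (Adj : V → V → Prop) (v : V) : ℕ :=
  max (indeg Adj v) (outdeg Adj v)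

/-- The number of edges of a digraph. -/
noncomputable def numEdges {V : Type*} (Adj : V → V → Prop) : ℕ :=
  Nat.card {e : V × V // Adj e.1 e.2}

/-- `(e,d)`-depth-robustness: for every set `S` of at most `e` vertices,
the graph minus `S` contains a directed path of length `d` (i.e. `d` edges). -/
def DepthRobust {V : Type*} (Adj : V → V → Prop) (e d : ℕ) : Prop :=
  ∀ S : Finset V, S.card ≤ e →
    ∃ p : List V, PathIn Adj p ∧ (∀ v ∈ p, v ∉ S) ∧ p.length = d + 1

/-- `(e,d)`-edge-depth-robustness: for every set `F` of at most `e` edges,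
the graph minus `F` contains a directed path of length `d`. -/
def EdgeDepthRobust {V : Type*} (Adj : V → V → Prop) (e d : ℕ) : Prop :=
  ∀ F : Finset (V × V), (∀ f ∈ F, Adj f.1 f.2) → F.card ≤ e →
    ∃ p : List V, PathIn (fun u w => Adj u w ∧ (u, w) ∉ F) p ∧ p.length = d + 1

/-- `u` is joined to `v` by a directed path all of whose vertices avoid `S`. -/
def ConnAvoiding {V : Type*} (Adj : V → V → Prop) (S : Finset V) (u v : V) : Prop :=
  ∃ p : List V, PathIn Adj p ∧ (∀ x ∈ p, x ∉ S) ∧ p.head? = some u ∧ p.getLast? = some v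

/-- `u` is joined to `v` by a directed path of length at least `d` avoiding `S`. -/
def ConnAvoidingLen {V : Type*} (Adj : V → V → Prop) (S : Finset V) (d : ℕ) (u v : V) : Prop :=
  ∃ p : List V, PathIn Adj p ∧ (∀ x ∈ p, x ∉ S) ∧ p.head? = some u ∧
    p.getLast? = some v ∧ d + 1 ≤ p.length

/-! ## Digraphs with designated inputs and outputs -/

/-- A finite digraph with `n` designated (distinct) inputs and `n` designated
(distinct) outputs. -/
structure IOGraph (n : ℕ) where
  V : Type
  [fin : Fintype V]
  [dec : DecidableEq V]
  Adj : V → V → Prop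
  inp : Fin n ↪ V
  out : Fin n ↪ V

attribute [instance] IOGraph.fin IOGraph.dec

/-- `(k1,k2)`-ST-robustness: after deleting any set `D` of at most `k1` vertices
there remain at least `k2` inputs and `k2` outputs such that every one of these
inputs is connected to every one of these outputs in `G - D`. -/
def STRobust {n : ℕ} (G : IOGraph n) (k1 k2 : ℕ) : Prop :=
  ∀ D : Finset G.V, D.card ≤ k1 →
    ∃ A B : Finset (Fin n), k2 ≤ A.card ∧ k2 ≤ B.card ∧
      ∀ a ∈ A, ∀ b ∈ B, ConnAvoiding G.Adj D (G.inp a) (G.out b)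

/-- `(k1,k2,d)`-ST-robustness: as `STRobust`, with all the connecting paths of
length at least `d`. -/
def STRobustD {n : ℕ} (G : IOGraph n) (k1 k2 d : ℕ) : Prop :=
  ∀ D : Finset G.V, D.card ≤ k1 →
    ∃ A B : Finset (Fin n), k2 ≤ A.card ∧ k2 ≤ B.card ∧
      ∀ a ∈ A, ∀ b ∈ B, ConnAvoidingLen G.Adj D d (G.inp a) (G.out b)

/-- Maximally ST-robust: `(k, n-k)`-ST-robust for all `0 ≤ k ≤ n`. -/
def MaxSTRobust {n : ℕ} (G : IOGraph n) : Prop := ∀ k ≤ n, STRobust G k (n - k)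

/-- Maximally ST-robust with depth `d`: `(k, n-k, d)`-ST-robust for all `0 ≤ k ≤ n`. -/
def MaxSTRobustD {n : ℕ} (G : IOGraph n) (d : ℕ) : Prop := ∀ k ≤ n, STRobustD G k (n - k) d

/-- An `n`-superconcentrator: for every `1 ≤ r ≤ n` and every `r` inputs and `r`
outputs there are `r` vertex-disjoint directed paths connecting the chosen inputs
to the chosen outputs. -/
def Superconcentrator {n : ℕ} (G : IOGraph n) : Prop :=
  ∀ r, 1 ≤ r → r ≤ n → ∀ X Y : Finset (Fin n), X.card = r → Y.card = r →
    ∃ P : Fin r → List G.V,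
      (∀ i, PathIn G.Adj (P i) ∧ (∃ x ∈ X, (P i).head? = some (G.inp x)) ∧
        ∃ y ∈ Y, (P i).getLast? = some (G.out y)) ∧
      ∀ i j, i ≠ j → ∀ v ∈ P i, v ∉ P j

/-- An `n`-connector: an `n`-superconcentrator such that moreover, for every
`1 ≤ r ≤ n`, every sequence of `r` distinct inputs and every sequence of `r`
distinct outputs, there are `r` vertex-disjoint directed paths where the `i`-th
path goes from the `i`-th chosen input to the `i`-th chosen output. -/
def Connector {n : ℕ} (G : IOGraph n) : Prop :=
  Superconcentrator G ∧
  ∀ r, 1 ≤ r → r ≤ n → ∀ x y : Fin r ↪ Fin n,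
    ∃ P : Fin r → List G.V,
      (∀ i, PathIn G.Adj (P i) ∧ (P i).head? = some (G.inp (x i)) ∧
        (P i).getLast? = some (G.out (y i))) ∧
      ∀ i j, i ≠ j → ∀ v ∈ P i, v ∉ P j

/-- A bundled finite digraph. -/
structure Dig where
  V : Type
  [fin : Fintype V]
  [dec : DecidableEq V]
  Adj : V → V → Prop

attribute [instance] Dig.fin Dig.dec

/-- `(s,t,ε)`-hardness of a graph together with a challenge set `VC`: for every
set `S` of at most `s` vertices, at least a `(1-ε)` fraction of the nodes of `VC`
have depth at least `t` in `G - S` (i.e. are the endpoint of a directed path of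
length `≥ t` in `G - S`). -/
def Hard {T : Type*} (Adj : T → T → Prop) (VC : Finset T) (s t : ℕ) (ε : ℝ) : Prop :=
  ∀ S : Finset T, S.card ≤ s →
    (1 - ε) * (VC.card : ℝ) ≤
      (Set.ncard {v | v ∈ VC ∧ ∃ p : List T, PathIn Adj p ∧ (∀ x ∈ p, x ∉ S) ∧
        p.getLast? = some v ∧ t + 1 ≤ p.length} : ℝ)

section Helpers
open Finset

lemma count_exists {R L : Type} [Fintype R] [DecidableEq R] [Fintype L] [DecidableEq L] (d : ℕ)
    (P : Finset (Finset R × Finset L)) (hL : 0 < Fintype.card L)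
    (h : ∑ p ∈ P, ((p.2.card : ℝ) / Fintype.card L) ^ (d * p.1.card) < 1) :
    ∃ nb : R → Fin d → L, ∀ p ∈ P, ∃ y ∈ p.1, ∃ i, nb y i ∉ p.2 := by
  classical
  by_contra hcon
  push Not at hcon
  let bad : Finset R × Finset L → Finset (R → Fin d → L) := fun p =>
    Fintype.piFinset (fun r => Fintype.piFinset (fun _ : Fin d => if r ∈ p.1 then p.2 else univ))
  have hbad : ∀ p, ((bad p).card : ℝ) =
      ((p.2.card : ℝ) / Fintype.card L) ^ (d * p.1.card) *
        ((Fintype.card L : ℝ) ^ d) ^ (Fintype.card R) := by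
    intro p
    have hl : (Fintype.card L : ℝ) ≠ 0 := by positivity
    have h1 : (bad p).card = (p.2.card ^ d) ^ p.1.card *
        ((Fintype.card L) ^ d) ^ (Fintype.card R - p.1.card) := by
      simp only [bad, Fintype.card_piFinset, prod_const, card_univ, Fintype.card_fin]
      have : ∀ r : R, (#(if r ∈ p.1 then p.2 else univ)) ^ d =
          if r ∈ p.1 then p.2.card ^ d else (Fintype.card L) ^ d := by
        intro r; split_ifs <;> simp
      rw [prod_congr rfl (fun r _ => this r), prod_ite]
      simp only [prod_const]
      congr 2
      · simp
      · rw [filter_not, card_sdiff]; simp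
    rw [h1]
    have h2 : p.1.card ≤ Fintype.card R := card_le_univ _
    obtain ⟨m, hm⟩ := Nat.exists_eq_add_of_le h2
    rw [hm]
    push_cast
    rw [Nat.add_sub_cancel_left, div_pow, pow_add, pow_mul, pow_mul]
    field_simp
  have hcov : (univ : Finset (R → Fin d → L)) ⊆ P.biUnion bad := by
    intro nb _
    obtain ⟨p, hp, hp'⟩ := hcon nb
    rw [mem_biUnion]
    refine ⟨p, hp, ?_⟩
    simp only [bad, Fintype.mem_piFinset]
    intro r i
    split_ifs with hr
    · exact hp' r hr i
    · simp
  have h3 := (card_le_card hcov).trans card_biUnion_le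
  have h4 : (((univ : Finset (R → Fin d → L)).card : ℕ) : ℝ) ≤ ∑ p ∈ P, ((bad p).card : ℝ) := by
    exact_mod_cast h3
  simp only [hbad, ← sum_mul] at h4
  simp only [card_univ, Fintype.card_fun, Fintype.card_fin] at h4
  push_cast at h4
  have h5 : (0:ℝ) < ((Fintype.card L : ℝ) ^ d) ^ (Fintype.card R) := by positivity
  nlinarith

lemma disperser (δ : ℝ) (h0 : 0 < δ) : ∃ d : ℕ, ∀ (R L : Type) [Fintype R] [DecidableEq R]
    [Fintype L] [DecidableEq L], 0 < Fintype.card R → 0 < Fintype.card L →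
    Fintype.card L ≤ Fintype.card R → ∃ nb : R → Fin d → L, ∀ (Y : Finset R) (X : Finset L),
      δ * Fintype.card R ≤ Y.card → δ * Fintype.card L ≤ X.card → ∃ y ∈ Y, ∃ e, nb y e ∈ X := by
  classical
  obtain ⟨d, hd⟩ := exists_nat_ge (2 / δ ^ 2)
  refine ⟨d, ?_⟩
  intro R L _ _ _ _ hR hL hLR
  let P : Finset (Finset R × Finset L) := univ.filter (fun p =>
    δ * Fintype.card R ≤ p.1.card ∧ (p.2.card : ℝ) ≤ (1 - δ) * Fintype.card L)
  have hsum : ∑ p ∈ P, ((p.2.card : ℝ) / Fintype.card L) ^ (d * p.1.card) < 1 := by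
    have hl : (0:ℝ) < (Fintype.card L : ℝ) := by positivity
    have hb : ∀ p ∈ P, ((p.2.card : ℝ) / Fintype.card L) ^ (d * p.1.card) ≤
        Real.exp (-2) ^ (Fintype.card R) := by
      intro p hp
      simp only [P, mem_filter, mem_univ, true_and] at hp
      have h1 : (p.2.card : ℝ) / Fintype.card L ≤ Real.exp (-δ) := by
        rw [div_le_iff₀ hl]
        refine hp.2.trans ?_
        gcongr
        exact Real.one_sub_le_exp_neg δ
      calc _ ≤ Real.exp (-δ) ^ (d * p.1.card) := by gcongr
        _ = Real.exp (-(δ * (d * p.1.card))) := by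
          rw [← Real.exp_nat_mul]; congr 1; push_cast; ring
        _ ≤ Real.exp (-(2 * Fintype.card R)) := by
          apply Real.exp_le_exp.mpr
          rw [neg_le_neg_iff]
          rw [div_le_iff₀ (by positivity)] at hd
          calc (2 * Fintype.card R : ℝ) ≤ d * δ ^ 2 * Fintype.card R := by gcongr
            _ = δ * d * (δ * Fintype.card R) := by ring
            _ ≤ δ * d * p.1.card := by gcongr; exact hp.1
            _ = _ := by ring
        _ = _ := by rw [← Real.exp_nat_mul]; congr 1; ring
    calc _ ≤ ∑ p ∈ P, Real.exp (-2) ^ (Fintype.card R) := sum_le_sum hb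
      _ = P.card * Real.exp (-2) ^ (Fintype.card R) := by simp
      _ ≤ (4 ^ (Fintype.card R) : ℝ) * Real.exp (-2) ^ (Fintype.card R) := by
        gcongr
        have : P.card ≤ 4 ^ (Fintype.card R) := by
          calc P.card ≤ Fintype.card (Finset R × Finset L) := card_le_univ _
            _ = 2 ^ Fintype.card R * 2 ^ Fintype.card L := by simp
            _ ≤ 2 ^ Fintype.card R * 2 ^ Fintype.card R := by gcongr; norm_num
            _ = _ := by rw [← mul_pow]; norm_num
        exact_mod_cast this
      _ = (4 * Real.exp (-2)) ^ (Fintype.card R) := by rw [mul_pow]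
      _ < 1 := by
        apply pow_lt_one₀ (by positivity) _ (by omega)
        have := Real.exp_one_gt_d9
        have h2 : Real.exp 2 = Real.exp 1 * Real.exp 1 := by rw [← Real.exp_add]; norm_num
        rw [Real.exp_neg, h2, ← div_eq_mul_inv, div_lt_one (by positivity)]
        nlinarith
  obtain ⟨nb, hnb⟩ := count_exists d P hL hsum
  refine ⟨nb, ?_⟩
  intro Y X hY hX
  obtain ⟨y, hy, i, hi⟩ := hnb (Y, Xᶜ) (by
    simp only [P, mem_filter, mem_univ, true_and]
    refine ⟨hY, ?_⟩
    rw [card_compl, Nat.cast_sub (card_le_univ _)]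
    linarith)
  exact ⟨y, hy, i, by simpa using hi⟩

lemma threshold {A B : Type} (X0 : Finset A) (Y0 : Finset B) (f : A → ℕ) (g : B → ℕ)
    (τ₁ τ₂ : ℝ) (h1 : 0 < τ₁) (h2 : 0 < τ₂) (t : ℕ) (ht : ∀ x ∈ X0, f x < t)
    (h : ∀ X ⊆ X0, ∀ Y ⊆ Y0, τ₁ ≤ X.card → τ₂ ≤ Y.card → ∃ x ∈ X, ∃ y ∈ Y, f x < g y) :
    ∃ θ ≤ t, ((X0.filter (fun x => θ ≤ f x)).card : ℝ) < τ₁ ∧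
      ((Y0.filter (fun y => g y < θ)).card : ℝ) < τ₂ := by
  classical
  have hex : ∃ θ, ((X0.filter (fun x => θ ≤ f x)).card : ℝ) < τ₁ := by
    refine ⟨t, ?_⟩
    rw [filter_eq_empty_iff.mpr]
    · simpa using h1
    · intro x hx; have := ht x hx; omega
  have htt : ((X0.filter (fun x => t ≤ f x)).card : ℝ) < τ₁ := by
    rw [filter_eq_empty_iff.mpr]
    · simpa using h1
    · intro x hx; have := ht x hx; omega
  refine ⟨Nat.find hex, Nat.find_min' hex htt, Nat.find_spec hex, ?_⟩
  rcases Nat.eq_zero_or_pos (Nat.find hex) with h0 | h0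
  · rw [h0]; simpa using h2
  · have hm := Nat.find_min hex (m := Nat.find hex - 1) (by omega)
    by_contra hc
    push Not at hc hm
    obtain ⟨x, hx, y, hy, hxy⟩ := h _ (filter_subset _ _) _ (filter_subset _ _) hm hc
    simp only [mem_filter] at hx hy
    omega

lemma choose_mono_half (n a b : ℕ) (hab : a ≤ b) (hb : 2 * b ≤ n) : n.choose a ≤ n.choose b := by
  induction b, hab using Nat.le_induction with
  | base => exact le_rfl
  | succ b hb' ih =>
    exact (ih (by omega)).trans (Nat.choose_le_succ_of_lt_half_left (by omega))

lemma choose_le_exp (n r : ℕ) (hr : 0 < r) :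
    (n.choose r : ℝ) ≤ (Real.exp 1 * n / r) ^ r := by
  have h1 : (n.choose r : ℝ) ≤ (n ^ r : ℝ) / r.factorial := Nat.choose_le_pow_div r n
  have h2 : (r : ℝ) ^ r / r.factorial ≤ Real.exp r :=
    Real.pow_div_factorial_le_exp (r : ℝ) (by positivity) r
  have h3 : Real.exp (r : ℝ) = Real.exp 1 ^ r := by rw [← Real.exp_nat_mul]; simp
  refine h1.trans ?_
  rw [h3, div_le_iff₀ (by positivity)] at h2
  rw [div_le_iff₀ (by positivity), div_pow, mul_pow, div_mul_eq_mul_div, le_div_iff₀ (by positivity)]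
  nlinarith [pow_nonneg (Nat.cast_nonneg (α := ℝ) n) r]

lemma exp_term (n l τ : ℕ) (hτ : 0 < τ) (h8 : 8 * τ < n) (hnl : n ≤ 2 * l) :
    (n.choose (τ / 4 + 1) : ℝ) * (l.choose τ : ℝ) * ((τ : ℝ) / l) ^ (20 * (τ / 4 + 1)) ≤
      (1 / 4 : ℝ) ^ τ := by
  have hl : (0:ℝ) < l := by
    have : 0 < l := by omega
    positivity
  have hτ' : (0:ℝ) < τ := by positivity
  have a1 : (n.choose (τ / 4 + 1) : ℝ) ≤ (Real.exp 1 * (2 * l : ℕ) / τ) ^ τ := by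
    refine le_trans ?_ (choose_le_exp _ _ hτ)
    have : n.choose (τ / 4 + 1) ≤ (2 * l).choose τ :=
      (choose_mono_half n _ τ (by omega) (by omega)).trans (Nat.choose_le_choose _ hnl)
    exact_mod_cast this
  have a2 := choose_le_exp l τ hτ
  have hx : (τ : ℝ) / l ≤ 1 / 4 := by
    rw [div_le_div_iff₀ hl (by norm_num)]
    have : τ * 4 ≤ 1 * l := by omega
    exact_mod_cast this
  have a3 : ((τ : ℝ) / l) ^ (20 * (τ / 4 + 1)) ≤ (((τ : ℝ) / l) ^ 5) ^ τ := by
    rw [← pow_mul]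
    apply pow_le_pow_of_le_one (by positivity) (by linarith)
    omega
  calc _ ≤ (Real.exp 1 * (2 * l : ℕ) / τ) ^ τ * (Real.exp 1 * l / τ) ^ τ * (((τ : ℝ) / l) ^ 5) ^ τ := by
        gcongr
    _ = (2 * Real.exp 1 ^ 2 * ((τ : ℝ) / l) ^ 3) ^ τ := by
        rw [← mul_pow, ← mul_pow]
        congr 1
        push_cast
        field_simp
    _ ≤ _ := by
        have he := Real.exp_one_lt_d9
        have he0 := Real.exp_pos 1
        have : ((τ : ℝ) / l) ^ 3 ≤ (1 / 4) ^ 3 := by gcongr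
        gcongr
        nlinarith

lemma expander (n l : ℕ) (hl : 0 < l) (hnl : n ≤ 2 * l) :
    ∃ nb : Fin n → Fin 20 → Fin l, ∀ (Y : Finset (Fin n)) (T : Finset (Fin l)),
      (∀ y ∈ Y, ∀ e, nb y e ∈ T) → n ≤ 8 * T.card ∨ 4 * Y.card ≤ T.card := by
  classical
  let I : Finset ℕ := (range n).filter (fun i => 8 * (i + 1) < n)
  let P : Finset (Finset (Fin n) × Finset (Fin l)) := I.biUnion (fun i =>
    powersetCard ((i + 1) / 4 + 1) univ ×ˢ powersetCard (i + 1) univ)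
  have hsum : ∑ p ∈ P, ((p.2.card : ℝ) / Fintype.card (Fin l)) ^ (20 * p.1.card) < 1 := by
    rw [sum_biUnion]
    · have : ∀ i ∈ I, ∑ p ∈ powersetCard ((i + 1) / 4 + 1) (univ : Finset (Fin n)) ×ˢ
          powersetCard (i + 1) (univ : Finset (Fin l)),
          ((p.2.card : ℝ) / Fintype.card (Fin l)) ^ (20 * p.1.card) ≤ (1 / 4 : ℝ) ^ (i + 1) := by
        intro i hi
        simp only [I, mem_filter] at hi
        refine le_trans (le_of_eq ?_) (exp_term n l (i + 1) (by omega) hi.2 hnl)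
        rw [sum_congr rfl (g := fun _ => (((i + 1 : ℕ) : ℝ) / l) ^ (20 * ((i + 1) / 4 + 1)))]
        · simp
        · intro p hp
          simp only [mem_product, mem_powersetCard] at hp
          rw [hp.1.2, hp.2.2, Fintype.card_fin]
      calc _ ≤ ∑ i ∈ I, (1 / 4 : ℝ) ^ (i + 1) := sum_le_sum this
        _ ≤ ∑ i ∈ range n, (1 / 4 : ℝ) ^ (i + 1) := by
          apply sum_le_sum_of_subset_of_nonneg (filter_subset _ _)
          intros; positivity
        _ < 1 := by
          simp only [pow_succ, ← sum_mul]
          rw [geom_sum_eq (by norm_num)]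
          have : (0:ℝ) < (1/4)^n := by positivity
          rw [div_mul_eq_mul_div, div_lt_one_of_neg (by norm_num)]
          linarith
    · intro i _ j _ hij
      rw [Function.onFun, disjoint_left]
      intro p hp hp'
      simp only [mem_product, mem_powersetCard] at hp hp'
      omega
  obtain ⟨nb, hnb⟩ := count_exists 20 P (by simpa using hl) hsum
  refine ⟨nb, ?_⟩
  intro Y T hYT
  by_contra hc
  push Not at hc
  have hT : 0 < T.card := by
    rw [card_pos]
    have : 0 < Y.card := by omega
    obtain ⟨y, hy⟩ := card_pos.mp this
    exact ⟨_, hYT y hy 0⟩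
  obtain ⟨Y', hY', hc'⟩ := exists_subset_card_eq (s := Y) (n := T.card / 4 + 1) (by omega)
  obtain ⟨y, hy, i, hi⟩ := hnb (Y', T) (by
    simp only [P, I, mem_biUnion, mem_filter, mem_range, mem_product, mem_powersetCard]
    refine ⟨T.card - 1, ⟨by omega, by omega⟩, ⟨subset_univ _, ?_⟩, subset_univ _, by omega⟩
    rw [hc']; congr 2; omega)
  exact hi (hYT y (hY' hy) i)

lemma chain_lemma (κ σ : ℕ)
    (eVV : ∀ i, Fin (2 ^ i) → Fin 20 → Fin (2 ^ (i + 1)))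
    (eVU : ∀ i, Fin (2 ^ i) → Fin 20 → Fin (2 ^ i))
    (eUU : ∀ i, Fin (2 ^ (i + 1)) → Fin 20 → Fin (2 ^ i))
    (hVV : ∀ i (Y : Finset (Fin (2 ^ i))) (T : Finset (Fin (2 ^ (i + 1)))), (∀ y ∈ Y, ∀ e, eVV i y e ∈ T) → 2 ^ i ≤ 8 * T.card ∨ 4 * Y.card ≤ T.card)
    (hVU : ∀ i (Y : Finset (Fin (2 ^ i))) (T : Finset (Fin (2 ^ i))), (∀ y ∈ Y, ∀ e, eVU i y e ∈ T) → 2 ^ i ≤ 8 * T.card ∨ 4 * Y.card ≤ T.card)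
    (hUU : ∀ i (Y : Finset (Fin (2 ^ (i + 1)))) (T : Finset (Fin (2 ^ i))), (∀ y ∈ Y, ∀ e, eUU i y e ∈ T) →
      2 ^ (i + 1) ≤ 8 * T.card ∨ 4 * Y.card ≤ T.card)
    (X SV B SU : ∀ i, Finset (Fin (2 ^ i)))
    (hSV : ∀ i ≤ κ, (SV i).card ≤ σ) (hSU : ∀ i ≤ κ, (SU i).card ≤ σ)
    (hX : ∀ i < κ, ∀ x ∈ X i, x ∉ SV i → ∀ e, eVV i x e ∈ X (i + 1))
    (hB : ∀ i ≤ κ, ∀ x ∈ B i, x ∉ SU i → ∀ e, eVU i x e ∈ X i)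
    (hB' : ∀ i < κ, ∀ x ∈ B (i + 1), x ∉ SU (i + 1) → ∀ e, eUU i x e ∈ B i)
    (htop : 32 * (X κ).card ≤ 2 ^ κ) :
    (B κ).card ≤ 64 * σ := by
  classical
  have hXs : ∀ j ≤ κ, 64 * σ ≤ 2 ^ (κ - j) → 32 * (X (κ - j)).card ≤ 2 ^ (κ - j) := by
    intro j
    induction j with
    | zero => intro _ _; simpa using htop
    | succ j ih =>
      intro hj hs
      have e1 : κ - j = (κ - (j + 1)) + 1 := by omega
      rw [e1] at ih
      set i := κ - (j + 1) with hi
      have hp : 2 ^ (i + 1) = 2 * 2 ^ i := by ring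
      have ih' := ih (by omega) (by omega)
      have h1 := hVV i (X i \ SV i) (X (i + 1)) (by
        intro y hy e
        rw [mem_sdiff] at hy
        exact hX i (by omega) y hy.1 hy.2 e)
      have h2 : (X i).card ≤ (X i \ SV i).card + (SV i).card := by
        have := card_le_card_sdiff_add_card (s := X i) (t := SV i)
        omega
      have h3 := hSV i (by omega)
      have : 0 < 2 ^ i := by positivity
      omega
  have hXs' : ∀ i ≤ κ, 64 * σ ≤ 2 ^ i → 32 * (X i).card ≤ 2 ^ i := by
    intro i hi h
    have := hXs (κ - i) (by omega)
    rw [show κ - (κ - i) = i by omega] at this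
    exact this h
  have key : ∀ i ≤ κ, (B i).card ≤ 64 * σ := by
    intro i
    induction i with
    | zero =>
      intro h0
      rcases Nat.lt_or_ge (64 * σ) (2 ^ 0) with h | h
      · have h1 := hXs' 0 h0 h.le
        have h2 := hVU 0 (B 0 \ SU 0) (X 0) (by
          intro y hy e
          rw [mem_sdiff] at hy
          exact hB 0 (by omega) y hy.1 hy.2 e)
        have h3 := hSU 0 h0
        have h4 := card_le_card_sdiff_add_card (s := B 0) (t := SU 0)
        omega
      · refine le_trans (card_le_univ _) ?_
        simpa using h
    | succ i ih =>
      intro hi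
      rcases Nat.lt_or_ge (64 * σ) (2 ^ (i + 1)) with h | h
      · have h1 := hXs' _ hi h.le
        have h2 := hVU (i + 1) (B (i + 1) \ SU (i + 1)) (X (i + 1)) (by
          intro y hy e
          rw [mem_sdiff] at hy
          exact hB _ hi y hy.1 hy.2 e)
        have h2' := hUU i (B (i + 1) \ SU (i + 1)) (B i) (by
          intro y hy e
          rw [mem_sdiff] at hy
          exact hB' i (by omega) y hy.1 hy.2 e)
        have h3 := hSU _ hi
        have h4 := card_le_card_sdiff_add_card (s := B (i + 1)) (t := SU (i + 1))
        have h5 := ih (by omega)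
        have : 0 < 2 ^ (i + 1) := by positivity
        omega
      · refine le_trans (card_le_univ _) ?_
        simpa using h
  exact key κ le_rfl

abbrev DN (k : ℕ) := Fin (2 ^ k) × Fin k × Bool

lemma src_lt (v j x : ℕ) (hx : x < 2 ^ j) (h : (v / 2 ^ j) % 2 = 1) :
    (v / 2 ^ j - 1) * 2 ^ j + x < v := by
  have h1 : v / 2 ^ j * 2 ^ j ≤ v := Nat.div_mul_le_self _ _
  obtain ⟨q, hq⟩ : ∃ q, v / 2 ^ j = q + 1 := by
    apply Nat.exists_eq_succ_of_ne_zero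
    intro h0; rw [h0] at h; simp at h
  rw [hq] at h1 ⊢
  rw [add_mul] at h1
  simp only [Nat.add_sub_cancel]
  omega

def dpar (k d : ℕ) (gad : Fin k → Fin d → Fin k) (nb : ∀ j, Fin (2 ^ j) → Fin d → Fin (2 ^ j)) :
    DN k → Finset (DN k)
  | (v, j, true) => univ.image (fun e => (v, gad j e, false))
  | (v, j, false) =>
    if h : (v.val / 2 ^ j.val) % 2 = 1 then
      univ.image (fun e => (⟨(v.val / 2 ^ j.val - 1) * 2 ^ j.val +
        (nb j.val ⟨v.val % 2 ^ j.val, Nat.mod_lt _ (by positivity)⟩ e).val,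
        (src_lt _ _ _ (Fin.isLt _) h).trans v.isLt⟩, j, true))
    else ∅

lemma dpar_card (k d : ℕ) (gad : Fin k → Fin d → Fin k)
    (nb : ∀ j, Fin (2 ^ j) → Fin d → Fin (2 ^ j)) (x : DN k) : (dpar k d gad nb x).card ≤ d := by
  obtain ⟨v, j, b⟩ := x
  cases b
  · simp only [dpar]
    split_ifs
    · refine card_image_le.trans (by simp)
    · simp
  · simp only [dpar]
    refine card_image_le.trans (by simp)

def drank (k : ℕ) (x : DN k) : ℕ := 2 * x.1.val + (if x.2.2 then 1 else 0)

lemma dpar_rank (k d : ℕ) (gad : Fin k → Fin d → Fin k)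
    (nb : ∀ j, Fin (2 ^ j) → Fin d → Fin (2 ^ j)) (x y : DN k) (h : x ∈ dpar k d gad nb y) :
    drank k x < drank k y := by
  obtain ⟨v, j, b⟩ := y
  cases b
  · simp only [dpar] at h
    split_ifs at h with hh
    · simp only [mem_image, mem_univ, true_and] at h
      obtain ⟨e, rfl⟩ := h
      simp only [drank]
      have := src_lt v.val j.val _ (nb j.val ⟨v.val % 2 ^ j.val, Nat.mod_lt _ (by positivity)⟩ e).isLt hh
      simp only [if_true]
      simp
      omega
    · simp at h
  · simp only [dpar] at h
    simp only [mem_image, mem_univ, true_and] at h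
    obtain ⟨e, rfl⟩ := h
    simp [drank]

lemma card_prod_filter {A B : Type} [Fintype A] [Fintype B] (p : A → B → Prop)
    [∀ a b, Decidable (p a b)] :
    #(univ.filter (fun x : A × B => p x.1 x.2)) = ∑ a, #(univ.filter (fun b => p a b)) := by
  simp only [card_filter, Fintype.sum_prod_type]

lemma card_prod_filter' {A B : Type} [Fintype A] [Fintype B] (p : A → B → Prop)
    [∀ a b, Decidable (p a b)] :
    #(univ.filter (fun x : A × B => p x.1 x.2)) = ∑ b, #(univ.filter (fun a => p a b)) := by
  simp only [card_filter, Fintype.sum_prod_type_right]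

lemma bits_inj (k v w : ℕ) (hv : v < 2 ^ k) (hw : w < 2 ^ k)
    (h : ∀ j < k, v / 2 ^ (j + 1) = w / 2 ^ (j + 1) → (v / 2 ^ j) % 2 = (w / 2 ^ j) % 2) :
    v = w := by
  have key : ∀ i ≤ k, v / 2 ^ (k - i) = w / 2 ^ (k - i) := by
    intro i
    induction i with
    | zero => intro _; simp [Nat.div_eq_of_lt hv, Nat.div_eq_of_lt hw]
    | succ i ih =>
      intro hi
      have ih' := ih (by omega)
      rw [show k - i = (k - (i + 1)) + 1 by omega] at ih'
      have h1 := h (k - (i + 1)) (by omega) ih'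
      rw [pow_succ, ← Nat.div_div_eq_div_mul, ← Nat.div_div_eq_div_mul] at ih'
      omega
  simpa using key k le_rfl

lemma D_core (k d : ℕ) (gad : Fin k → Fin d → Fin k)
    (nb : ∀ j, Fin (2 ^ j) → Fin d → Fin (2 ^ j)) (δ : ℝ) (hδ : 0 < δ) (hk : 0 < k)
    (hgad : ∀ (Y X : Finset (Fin k)), δ * k ≤ Y.card → δ * k ≤ X.card →
      ∃ y ∈ Y, ∃ e, gad y e ∈ X)
    (hnb : ∀ j, ∀ (Y X : Finset (Fin (2 ^ j))), δ * (2 ^ j : ℕ) ≤ Y.card →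
      δ * (2 ^ j : ℕ) ≤ X.card → ∃ y ∈ Y, ∃ e, nb j y e ∈ X)
    (Dead : Finset (DN k)) (lam : DN k → ℕ) (t : ℕ) (hlt : ∀ x, x ∉ Dead → lam x < t)
    (hinc : ∀ x y, x ∈ dpar k d gad nb y → x ∉ Dead → y ∉ Dead → lam x < lam y) :
    ∃ (M : Fin (2 ^ k) → Finset (Fin k)) (μ : Fin (2 ^ k) → ℕ), (∀ v, μ v ≤ t) ∧
      (∀ v w, μ v = μ w → M v = M w → v = w) ∧
      (∑ v, ((M v).card : ℝ)) ≤ Dead.card + 3 * δ * k * 2 ^ k := by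
  classical
  have hkk : (0:ℝ) < k := by positivity
  have hmu : ∀ v : Fin (2 ^ k), ∃ θ ≤ t,
      ((univ.filter (fun j : Fin k => (v, j, false) ∉ Dead ∧ θ ≤ lam (v, j, false))).card : ℝ) < δ * k ∧
      ((univ.filter (fun j : Fin k => (v, j, true) ∉ Dead ∧ lam (v, j, true) < θ)).card : ℝ) < δ * k := by
    intro v
    obtain ⟨θ, h1, h2, h3⟩ := threshold
      (univ.filter (fun j : Fin k => (v, j, false) ∉ Dead))
      (univ.filter (fun j : Fin k => (v, j, true) ∉ Dead))
      (fun j => lam (v, j, false)) (fun j => lam (v, j, true)) (δ * k) (δ * k)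
      (by positivity) (by positivity) t
      (by intro j hj; simp only [mem_filter, mem_univ, true_and] at hj; exact hlt _ hj)
      (by
        intro X hX Y hY hXc hYc
        obtain ⟨y, hy, e, he⟩ := hgad Y X hYc hXc
        refine ⟨_, he, y, hy, ?_⟩
        have a1 := hX he
        have a2 := hY hy
        simp only [mem_filter, mem_univ, true_and] at a1 a2
        refine hinc _ _ ?_ a1 a2
        simp only [dpar, mem_image, mem_univ, true_and]
        exact ⟨e, rfl⟩)
    refine ⟨θ, h1, ?_, ?_⟩
    · rw [filter_filter] at h2; exact h2
    · rw [filter_filter] at h3; exact h3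
  choose μ hμt hμ1 hμ2 using hmu
  let G : Fin (2 ^ k) → Fin k → Prop := fun v j => (v, j, false) ∉ Dead ∧ (v, j, true) ∉ Dead ∧
    lam (v, j, false) < μ v ∧ μ v ≤ lam (v, j, true)
  let μ' : ℕ → ℕ := fun n => if h : n < 2 ^ k then μ ⟨n, h⟩ else 0
  let G' : ℕ → Fin k → Prop := fun n j => ∃ h : n < 2 ^ k, G ⟨n, h⟩ j
  have hth : ∀ (j : Fin k) (p : ℕ), ∃ θ : ℕ,
      ((univ.filter (fun x : Fin (2 ^ j.val) => G' (2 * p * 2 ^ j.val + x.val) j ∧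
        θ ≤ μ' (2 * p * 2 ^ j.val + x.val))).card : ℝ) < δ * (2 ^ j.val : ℕ) ∧
      ((univ.filter (fun x : Fin (2 ^ j.val) => G' ((2 * p + 1) * 2 ^ j.val + x.val) j ∧
        μ' ((2 * p + 1) * 2 ^ j.val + x.val) < θ)).card : ℝ) < δ * (2 ^ j.val : ℕ) := by
    intro j p
    obtain ⟨θ, h1, h2, h3⟩ := threshold
      (univ.filter (fun x : Fin (2 ^ j.val) => G' (2 * p * 2 ^ j.val + x.val) j))
      (univ.filter (fun x : Fin (2 ^ j.val) => G' ((2 * p + 1) * 2 ^ j.val + x.val) j))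
      (fun x => μ' (2 * p * 2 ^ j.val + x.val)) (fun x => μ' ((2 * p + 1) * 2 ^ j.val + x.val))
      (δ * (2 ^ j.val : ℕ)) (δ * (2 ^ j.val : ℕ))
      (by positivity) (by positivity) (t + 1)
      (by
        intro x hx
        simp only [mem_filter, mem_univ, true_and] at hx
        obtain ⟨h, _⟩ := hx
        simp only [μ', h, dite_true]
        have := hμt ⟨_, h⟩
        omega)
      (by
        intro X hX Y hY hXc hYc
        obtain ⟨y, hy, e, he⟩ := hnb _ Y X hYc hXc
        refine ⟨_, he, y, hy, ?_⟩
        have a1 := hX he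
        have a2 := hY hy
        simp only [mem_filter, mem_univ, true_and] at a1 a2
        obtain ⟨b1, c1⟩ := a1
        obtain ⟨b2, c2⟩ := a2
        simp only [μ', b1, b2, dite_true]
        refine lt_of_le_of_lt c1.2.2.2 (lt_trans ?_ c2.2.2.1)
        refine hinc _ _ ?_ c1.2.1 c2.1
        have hpos : 0 < 2 ^ j.val := by positivity
        have d1 : ((2 * p + 1) * 2 ^ j.val + y.val) / 2 ^ j.val = 2 * p + 1 := by
          rw [mul_comm, Nat.mul_add_div hpos, Nat.div_eq_of_lt y.isLt]
        have d2 : ((2 * p + 1) * 2 ^ j.val + y.val) % 2 ^ j.val = y.val := by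
          rw [mul_comm, Nat.mul_add_mod, Nat.mod_eq_of_lt y.isLt]
        have d3 : (((2 * p + 1) * 2 ^ j.val + y.val) / 2 ^ j.val) % 2 = 1 := by
          rw [d1]; omega
        simp only [dpar]
        simp only [d3, dite_true, mem_image, mem_univ, true_and]
        refine ⟨e, ?_⟩
        simp only [d1, d2, Nat.add_sub_cancel])
    refine ⟨θ, ?_, ?_⟩
    · rw [filter_filter] at h2; exact h2
    · rw [filter_filter] at h3; exact h3
  choose θ hθ1 hθ2 using hth
  let mism : Fin (2 ^ k) → Fin k → Prop := fun v j =>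
    ¬ (θ j (v.val / 2 ^ (j.val + 1)) ≤ μ v ↔ (v.val / 2 ^ j.val) % 2 = 1)
  refine ⟨fun v => univ.filter (mism v), μ, hμt, ?_, ?_⟩
  · intro v w hvw hM
    apply Fin.ext
    apply bits_inj k _ _ v.isLt w.isLt
    intro j hj hq
    have h1 : mism v ⟨j, hj⟩ ↔ mism w ⟨j, hj⟩ := by
      have := congrArg (fun s => (⟨j, hj⟩ : Fin k) ∈ s) hM
      simpa using this
    simp only [mism] at h1
    rw [hq, hvw] at h1
    have h2 := Nat.mod_lt (v.val / 2 ^ j) (show 0 < 2 by norm_num)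
    have h3 := Nat.mod_lt (w.val / 2 ^ j) (show 0 < 2 by norm_num)
    by_cases c : θ ⟨j, hj⟩ (w.val / 2 ^ (j + 1)) ≤ μ w
    · simp only [c, true_iff] at h1; omega
    · simp only [c, false_iff] at h1; omega
  · have e1 : (∑ v, ((univ.filter (mism v)).card : ℝ)) =
        ((univ.filter (fun x : Fin (2 ^ k) × Fin k => mism x.1 x.2)).card : ℝ) := by
      rw [card_prod_filter mism]; push_cast; rfl
    rw [e1]
    have hsub : univ.filter (fun x : Fin (2 ^ k) × Fin k => mism x.1 x.2) ⊆
        (Dead.image (fun x => (x.1, x.2.1))) ∪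
        (univ.filter (fun x : Fin (2 ^ k) × Fin k => (x.1, x.2, false) ∉ Dead ∧ μ x.1 ≤ lam (x.1, x.2, false))) ∪
        (univ.filter (fun x : Fin (2 ^ k) × Fin k => (x.1, x.2, true) ∉ Dead ∧ lam (x.1, x.2, true) < μ x.1)) ∪
        (univ.filter (fun x : Fin (2 ^ k) × Fin k => G x.1 x.2 ∧ mism x.1 x.2)) := by
      rintro ⟨v, j⟩ hx
      simp only [mem_filter, mem_univ, true_and] at hx
      simp only [mem_union, mem_filter, mem_univ, true_and, mem_image, hx, and_true]
      by_cases c1 : (v, j, false) ∈ Dead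
      · exact Or.inl (Or.inl (Or.inl ⟨_, c1, rfl⟩))
      by_cases c2 : (v, j, true) ∈ Dead
      · exact Or.inl (Or.inl (Or.inl ⟨_, c2, rfl⟩))
      by_cases c3 : μ v ≤ lam (v, j, false)
      · exact Or.inl (Or.inl (Or.inr ⟨c1, c3⟩))
      by_cases c4 : lam (v, j, true) < μ v
      · exact Or.inl (Or.inr ⟨c2, c4⟩)
      exact Or.inr ⟨c1, c2, by omega, by omega⟩
    have q1 := card_le_card hsub
    have q2 := q1.trans ((card_union_le _ _).trans (Nat.add_le_add_right ((card_union_le _ _).trans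
      (Nat.add_le_add_right ((card_union_le _ _).trans (Nat.add_le_add_right card_image_le _)) _)) _))
    have q3 : ((univ.filter (fun x : Fin (2 ^ k) × Fin k => (x.1, x.2, false) ∉ Dead ∧
        μ x.1 ≤ lam (x.1, x.2, false))).card : ℝ) ≤ δ * k * 2 ^ k := by
      rw [card_prod_filter (fun v j => (v, j, false) ∉ Dead ∧ μ v ≤ lam (v, j, false))]
      push_cast
      refine (sum_le_sum (fun v _ => (hμ1 v).le)).trans (le_of_eq ?_)
      simp; ring
    have q4 : ((univ.filter (fun x : Fin (2 ^ k) × Fin k => (x.1, x.2, true) ∉ Dead ∧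
        lam (x.1, x.2, true) < μ x.1)).card : ℝ) ≤ δ * k * 2 ^ k := by
      rw [card_prod_filter (fun v j => (v, j, true) ∉ Dead ∧ lam (v, j, true) < μ v)]
      push_cast
      refine (sum_le_sum (fun v _ => (hμ2 v).le)).trans (le_of_eq ?_)
      simp; ring
    have q5 : ((univ.filter (fun x : Fin (2 ^ k) × Fin k => G x.1 x.2 ∧ mism x.1 x.2)).card : ℝ)
        ≤ δ * k * 2 ^ k := by
      rw [card_prod_filter' (fun v j => G v j ∧ mism v j)]
      push_cast
      have : ∀ j : Fin k, ((univ.filter (fun v => G v j ∧ mism v j)).card : ℝ) ≤ δ * 2 ^ k := by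
        intro j
        have hpos : 0 < 2 ^ j.val := by positivity
        have hpk : 2 ^ (k - j.val) * 2 ^ j.val = 2 ^ k := by
          rw [← pow_add]; congr 1; omega
        rw [card_eq_sum_card_fiberwise (f := fun v : Fin (2 ^ k) => v.val / 2 ^ j.val)
          (t := range (2 ^ (k - j.val)))]
        · push_cast
          have hf : ∀ q ∈ range (2 ^ (k - j.val)),
              (((univ.filter (fun v => G v j ∧ mism v j)).filter
                (fun v : Fin (2 ^ k) => v.val / 2 ^ j.val = q)).card : ℝ) ≤ δ * (2 ^ j.val : ℕ) := by
            intro q _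
            have hdm : ∀ v : Fin (2 ^ k), v.val / 2 ^ j.val = q →
                q * 2 ^ j.val + v.val % 2 ^ j.val = v.val := by
              intro v hv
              rw [← hv]; exact Nat.div_add_mod' _ _
            have hmu' : ∀ v : Fin (2 ^ k), μ' v.val = μ v := by
              intro v; simp only [μ', v.isLt, dite_true]
            rcases Nat.even_or_odd' q with ⟨p, hp | hp⟩
            · refine le_trans ?_ (hθ1 j p).le
              norm_cast
              apply card_le_card_of_injOn (fun v => ⟨v.val % 2 ^ j.val, Nat.mod_lt _ hpos⟩)
              · intro v hv
                simp only [coe_filter, mem_filter, mem_univ, true_and, Set.mem_ofPred_eq] at hv ⊢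
                obtain ⟨⟨g, m⟩, hq⟩ := hv
                rw [← hp, hdm v hq, hmu']
                refine ⟨⟨v.isLt, g⟩, ?_⟩
                have hq2 : v.val / 2 ^ (j.val + 1) = p := by
                  rw [pow_succ, ← Nat.div_div_eq_div_mul, hq]; omega
                simp only [mism, hq, hq2] at m
                by_contra hc
                apply m
                constructor
                · intro h; exact absurd h hc
                · intro h; omega
              · intro v hv w hw hvw
                simp only [coe_filter, mem_filter, mem_univ, true_and, Set.mem_ofPred_eq] at hv hw
                simp only [Fin.mk.injEq] at hvw
                apply Fin.ext
                rw [← hdm v hv.2, ← hdm w hw.2, hvw]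
            · refine le_trans ?_ (hθ2 j p).le
              norm_cast
              apply card_le_card_of_injOn (fun v => ⟨v.val % 2 ^ j.val, Nat.mod_lt _ hpos⟩)
              · intro v hv
                simp only [coe_filter, mem_filter, mem_univ, true_and, Set.mem_ofPred_eq] at hv ⊢
                obtain ⟨⟨g, m⟩, hq⟩ := hv
                rw [← hp, hdm v hq, hmu']
                refine ⟨⟨v.isLt, g⟩, ?_⟩
                have hq2 : v.val / 2 ^ (j.val + 1) = p := by
                  rw [pow_succ, ← Nat.div_div_eq_div_mul, hq]; omega
                simp only [mism, hq, hq2] at m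
                by_contra hc
                apply m
                constructor
                · intro h; omega
                · intro h; omega
              · intro v hv w hw hvw
                simp only [coe_filter, mem_filter, mem_univ, true_and, Set.mem_ofPred_eq] at hv hw
                simp only [Fin.mk.injEq] at hvw
                apply Fin.ext
                rw [← hdm v hv.2, ← hdm w hw.2, hvw]
          refine (sum_le_sum hf).trans (le_of_eq ?_)
          rw [sum_const, card_range, nsmul_eq_mul]
          have : ((2 ^ (k - j.val) * 2 ^ j.val : ℕ) : ℝ) = 2 ^ k := by rw [hpk]; push_cast; rfl
          rw [← this]; push_cast; ring
        · intro v _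
          simp only [coe_range, Set.mem_Iio]
          rw [Nat.div_lt_iff_lt_mul hpos, hpk]
          exact v.isLt
      refine (sum_le_sum (fun j _ => this j)).trans (le_of_eq ?_)
      simp; ring
    have q6 := (Nat.cast_le (α := ℝ)).mpr q2
    push_cast at q6
    linarith


lemma D_count (k t : ℕ) (M : Fin (2 ^ k) → Finset (Fin k)) (μ : Fin (2 ^ k) → ℕ)
    (hμ : ∀ v, μ v ≤ t) (hinj : ∀ v w, μ v = μ w → M v = M w → v = w) (a ζ : ℝ) (ha : 0 ≤ a)
    (hsum : (∑ v, ((M v).card : ℝ)) ≤ ζ * k * 2 ^ k) :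
    2 ^ k * Real.exp (-(a * ζ * k)) ≤ (t + 1) * Real.exp (Real.exp (-a) * k) := by
  classical
  have up : ∑ v, Real.exp (-a) ^ (M v).card ≤ (t + 1) * Real.exp (Real.exp (-a) * k) := by
    have h1 : ∑ v, Real.exp (-a) ^ (M v).card =
        ∑ p ∈ univ.image (fun v => (μ v, M v)), Real.exp (-a) ^ (p.2).card := by
      rw [sum_image]
      intro v _ w _ h
      simp only [Prod.mk.injEq] at h
      exact hinj v w h.1 h.2
    rw [h1]
    have h2 : univ.image (fun v => (μ v, M v)) ⊆ range (t + 1) ×ˢ (univ : Finset (Finset (Fin k))) := by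
      intro p hp
      simp only [mem_image, mem_univ, true_and] at hp
      obtain ⟨v, rfl⟩ := hp
      simp only [mem_product, mem_range, mem_univ, and_true]
      have := hμ v
      omega
    refine (sum_le_sum_of_subset_of_nonneg h2 (fun _ _ _ => by positivity)).trans ?_
    rw [sum_product]
    simp only [sum_const, card_range, nsmul_eq_mul]
    have h3 := Fintype.sum_pow_mul_eq_add_pow (Fin k) (Real.exp (-a)) 1
    simp only [one_pow, mul_one, Fintype.card_fin] at h3
    rw [h3]
    push_cast
    apply mul_le_mul_of_nonneg_left _ (by positivity)
    rw [mul_comm (Real.exp (-a)), Real.exp_nat_mul]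
    exact pow_le_pow_left₀ (by positivity) (Real.add_one_le_exp _) _
  refine le_trans ?_ up
  have lo : ∀ v, Real.exp (-(a * ζ * k)) * (1 + (a * ζ * k - a * (M v).card)) ≤
      Real.exp (-a) ^ (M v).card := by
    intro v
    rw [← Real.exp_nat_mul]
    have := Real.add_one_le_exp (a * ζ * k - a * (M v).card)
    calc _ ≤ Real.exp (-(a * ζ * k)) * Real.exp (a * ζ * k - a * (M v).card) :=
          mul_le_mul_of_nonneg_left (by linarith) (by positivity)
      _ = _ := by rw [← Real.exp_add]; congr 1; ring
  refine le_trans ?_ (sum_le_sum (fun v _ => lo v))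
  rw [← mul_sum, mul_comm]
  apply mul_le_mul_of_nonneg_left _ (by positivity)
  have hm : ∑ v, a * ((M v).card : ℝ) = a * ∑ v, ((M v).card : ℝ) := by rw [mul_sum]
  rw [sum_add_distrib, sum_sub_distrib, hm]
  simp only [sum_const, card_univ, Fintype.card_fin, nsmul_eq_mul]
  push_cast
  nlinarith [mul_le_mul_of_nonneg_left hsum ha]

lemma D_thm (η : ℝ) (hη : 0 < η) : ∃ (c : ℝ) (d : ℕ), 0 < c ∧ c ≤ 1 / 65 ∧ ∀ k : ℕ, 0 < k →
    ∃ (gad : Fin k → Fin d → Fin k) (nb : ∀ j, Fin (2 ^ j) → Fin d → Fin (2 ^ j)),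
    ∀ (Dead : Finset (DN k)) (lam : DN k → ℕ) (t : ℕ), (∀ x, x ∉ Dead → lam x < t) →
    (∀ x y, x ∈ dpar k d gad nb y → x ∉ Dead → y ∉ Dead → lam x < lam y) →
    (Dead.card : ℝ) ≤ c * k * 2 ^ k → 2 ^ k * Real.exp (-(η * k)) ≤ t + 1 := by
  obtain ⟨a, ha0, ha⟩ : ∃ a : ℝ, 0 < a ∧ Real.exp (-a) ≤ η / 2 := by
    refine ⟨max 1 (-Real.log (η / 2)), by positivity, ?_⟩
    rw [← Real.exp_log (show 0 < η / 2 by positivity)]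
    apply Real.exp_le_exp.mpr
    have := le_max_right 1 (-Real.log (η / 2))
    rw [Real.exp_log (show 0 < η / 2 by positivity)]
    linarith
  let ζ := η / (2 * a)
  have hζ : 0 < ζ := by positivity
  obtain ⟨d, hd⟩ := disperser (ζ / 4) (by positivity)
  refine ⟨min (ζ / 4) (1 / 65), d, by positivity, min_le_right _ _, ?_⟩
  intro k hk
  obtain ⟨gad, hgad⟩ := hd (Fin k) (Fin k) (by simpa) (by simpa) (by simp)
  have hnb := fun j => hd (Fin (2 ^ j)) (Fin (2 ^ j)) (by simp) (by simp) (by simp)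
  choose nb hnb using hnb
  refine ⟨gad, nb, ?_⟩
  intro Dead lam t hlt hinc hcard
  simp only [Fintype.card_fin] at hgad hnb
  obtain ⟨M, μ, h1, h2, h3⟩ := D_core k d gad nb (ζ / 4) (by positivity) hk hgad hnb Dead lam t hlt hinc
  have h4 := D_count k t M μ h1 h2 a ζ ha0.le (by
    refine h3.trans ?_
    have : min (ζ / 4) (1 / 65) * k * 2 ^ k ≤ ζ / 4 * k * 2 ^ k := by
      gcongr; exact min_le_left _ _
    linarith)
  have haz : a * ζ = η / 2 := by simp only [ζ]; field_simp
  rw [haz] at h4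
  have h5 : Real.exp (Real.exp (-a) * k) ≤ Real.exp (η / 2 * k) := by
    apply Real.exp_le_exp.mpr; gcongr
  have h6 : 2 ^ k * Real.exp (-(η / 2 * k)) ≤ (t + 1) * Real.exp (η / 2 * k) :=
    h4.trans (by gcongr)
  have h7 : (2:ℝ) ^ k * Real.exp (-(η * k)) = 2 ^ k * Real.exp (-(η / 2 * k)) * Real.exp (-(η / 2 * k)) := by
    rw [mul_assoc, ← Real.exp_add]; congr 2; ring
  rw [h7]
  calc _ ≤ (t + 1) * Real.exp (η / 2 * k) * Real.exp (-(η / 2 * k)) := by gcongr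
    _ = t + 1 := by rw [mul_assoc, ← Real.exp_add]; simp


/-! ### Depth -/

def Dp {T : Type} (Adj : T → T → Prop) (S : Finset T) (n : ℕ) (v : T) : Prop :=
  ∃ p : List T, PathIn Adj p ∧ (∀ x ∈ p, x ∉ S) ∧ p.getLast? = some v ∧ n + 1 ≤ p.length

lemma Dp_zero {T : Type} {Adj : T → T → Prop} {S : Finset T} {v : T} (h : v ∉ S) :
    Dp Adj S 0 v := by
  refine ⟨[v], ⟨by simp, ?_⟩, by simpa using h, by simp, by simp⟩
  exact List.isChain_singleton _

lemma Dp_succ {T : Type} {Adj : T → T → Prop} {S : Finset T} {n : ℕ} {u v : T} (h : v ∉ S)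
    (hu : Dp Adj S n u) (ha : Adj u v) : Dp Adj S (n + 1) v := by
  obtain ⟨p, ⟨h1, h2⟩, h3, h4, h5⟩ := hu
  refine ⟨p ++ [v], ⟨by simp, ?_⟩, ?_, by simp, by simp; omega⟩
  · apply List.isChain_append.2
    refine ⟨h2, List.isChain_singleton _, ?_⟩
    intro x hx y hy
    rw [h4] at hx
    simp at hx hy
    subst hx; subst hy; exact ha
  · intro x hx
    rcases List.mem_append.1 hx with hx | hx
    · exact h3 x hx
    · simp at hx; subst hx; exact h

lemma Dp_mono {T : Type} {Adj : T → T → Prop} {S : Finset T} {m n : ℕ} {v : T} (hmn : m ≤ n)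
    (h : Dp Adj S n v) : Dp Adj S m v := by
  obtain ⟨p, h1, h3, h4, h5⟩ := h
  exact ⟨p, h1, h3, h4, by omega⟩

lemma Dp_step {T : Type} {Adj : T → T → Prop} {S : Finset T} {n : ℕ} {u v : T} (h : v ∉ S)
    (hu : Dp Adj S n u) (ha : Adj u v) : Dp Adj S n v :=
  Dp_mono (Nat.le_succ n) (Dp_succ h hu ha)

open Classical in
noncomputable def lamD {T : Type} (Adj : T → T → Prop) (S : Finset T) (t : ℕ) (v : T) : ℕ :=
  Nat.findGreatest (fun n => Dp Adj S n v) t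

lemma lamD_spec {T : Type} {Adj : T → T → Prop} {S : Finset T} {t : ℕ} {v : T} (h : v ∉ S) :
    Dp Adj S (lamD Adj S t v) v := by
  classical
  unfold lamD
  convert Nat.findGreatest_spec (P := fun n => Dp Adj S n v) (Nat.zero_le t) (Dp_zero h)

lemma lamD_lt {T : Type} {Adj : T → T → Prop} {S : Finset T} {t : ℕ} {v : T} (h : v ∉ S)
    (hn : ¬ Dp Adj S t v) : lamD Adj S t v < t := by
  classical
  have h1 : lamD Adj S t v ≤ t := Nat.findGreatest_le t
  rcases h1.lt_or_eq with h2 | h2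
  · exact h2
  · exact absurd (h2 ▸ lamD_spec h) hn

lemma lamD_inc {T : Type} {Adj : T → T → Prop} {S : Finset T} {t : ℕ} {u v : T} (hu : u ∉ S)
    (hun : ¬ Dp Adj S t u) (hv : v ∉ S) (ha : Adj u v) : lamD Adj S t u < lamD Adj S t v := by
  classical
  have h1 := lamD_lt hu hun
  have h2 := Dp_succ hv (lamD_spec (t := t) hu) ha
  have h3 : lamD Adj S t u + 1 ≤ lamD Adj S t v :=
    Nat.le_findGreatest (P := fun n => Dp Adj S n v) h1 h2
  exact h3

/-! ### The graph -/

abbrev Lv (κ : ℕ) := Σ i : Fin (κ + 1), Fin (2 ^ i.val)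

abbrev GNode (k κ N : ℕ) := DN k ⊕ (Lv κ ⊕ (Lv κ ⊕ Fin N))

structure GP (k d d' : ℕ) where
  gad : Fin k → Fin d → Fin k
  nb : ∀ j, Fin (2 ^ j) → Fin d → Fin (2 ^ j)
  eDV : ∀ i, Fin (2 ^ i) → Fin d' → DN k
  eVV : ∀ i, Fin (2 ^ i) → Fin 20 → Fin (2 ^ (i + 1))
  eVU : ∀ i, Fin (2 ^ i) → Fin 20 → Fin (2 ^ i)
  eUU : ∀ i, Fin (2 ^ (i + 1)) → Fin 20 → Fin (2 ^ i)

def dN {k κ N : ℕ} (x : DN k) : GNode k κ N := Sum.inl x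
def vN {k κ N : ℕ} (i : ℕ) (h : i ≤ κ) (x : Fin (2 ^ i)) : GNode k κ N :=
  Sum.inr (Sum.inl ⟨⟨i, Nat.lt_succ_of_le h⟩, x⟩)
def uN {k κ N : ℕ} (i : ℕ) (h : i ≤ κ) (x : Fin (2 ^ i)) : GNode k κ N :=
  Sum.inr (Sum.inr (Sum.inl ⟨⟨i, Nat.lt_succ_of_le h⟩, x⟩))
def oN {k κ N : ℕ} (y : Fin N) : GNode k κ N := Sum.inr (Sum.inr (Sum.inr y))

def vpar {k d d' : ℕ} (P : GP k d d') (κ N i : ℕ) (x : Fin (2 ^ i)) : Finset (GNode k κ N) :=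
  if h : i < κ then univ.image (fun e => vN (i + 1) h (P.eVV i x e))
  else univ.image (fun e => dN (P.eDV i x e))

def upar {k d d' : ℕ} (P : GP k d d') (κ N : ℕ) : (i : ℕ) → i ≤ κ → Fin (2 ^ i) → Finset (GNode k κ N)
  | 0, h, x => univ.image (fun e => vN 0 h (P.eVU 0 x e))
  | i + 1, h, x => univ.image (fun e => vN (i + 1) h (P.eVU (i + 1) x e)) ∪
      univ.image (fun e => uN i (Nat.le_of_succ_le h) (P.eUU i x e))

def opar {k κ N : ℕ} (y : Fin N) : Finset (GNode k κ N) :=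
  univ.image (fun r : Fin 65 => uN κ le_rfl ⟨(65 * y.val + r.val) % 2 ^ κ, Nat.mod_lt _ (by positivity)⟩)

def gpar {k d d' : ℕ} (P : GP k d d') (κ N : ℕ) : GNode k κ N → Finset (GNode k κ N)
  | Sum.inl x => (dpar k d P.gad P.nb x).image dN
  | Sum.inr (Sum.inl ⟨i, x⟩) => vpar P κ N i.val x
  | Sum.inr (Sum.inr (Sum.inl ⟨i, x⟩)) => upar P κ N i.val (Nat.le_of_lt_succ i.isLt) x
  | Sum.inr (Sum.inr (Sum.inr y)) => opar y

def gadj {k d d' : ℕ} (P : GP k d d') (κ N : ℕ) (u v : GNode k κ N) : Prop := u ∈ gpar P κ N v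

lemma gadj_D {k d d' : ℕ} (P : GP k d d') (κ N : ℕ) (x y : DN k) (h : x ∈ dpar k d P.gad P.nb y) :
    gadj P κ N (dN x) (dN y) := mem_image_of_mem _ h

lemma gadj_DV {k d d' : ℕ} (P : GP k d d') (κ N : ℕ) (x : Fin (2 ^ κ)) (e : Fin d') :
    gadj P κ N (dN (P.eDV κ x e)) (vN κ le_rfl x) := by
  simp [gadj, vN, gpar, vpar]

lemma gadj_VV {k d d' : ℕ} (P : GP k d d') (κ N i : ℕ) (h : i < κ) (x : Fin (2 ^ i)) (e : Fin 20) :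
    gadj P κ N (vN (i + 1) h (P.eVV i x e)) (vN i h.le x) := by
  have : gpar P κ N (vN i h.le x) = vpar P κ N i x := rfl
  rw [gadj, this, vpar, dif_pos h]
  exact mem_image_of_mem _ (mem_univ e)

lemma gadj_VU {k d d' : ℕ} (P : GP k d d') (κ N i : ℕ) (h : i ≤ κ) (x : Fin (2 ^ i)) (e : Fin 20) :
    gadj P κ N (vN i h (P.eVU i x e)) (uN i h x) := by
  have : gpar P κ N (uN i h x) = upar P κ N i h x := rfl
  rw [gadj, this]
  cases i with
  | zero => exact mem_image_of_mem _ (mem_univ e)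
  | succ i => exact mem_union_left _ (mem_image_of_mem _ (mem_univ e))

lemma gadj_UU {k d d' : ℕ} (P : GP k d d') (κ N i : ℕ) (h : i < κ) (x : Fin (2 ^ (i + 1))) (e : Fin 20) :
    gadj P κ N (uN i h.le (P.eUU i x e)) (uN (i + 1) h x) := by
  have : gpar P κ N (uN (i + 1) h x) = upar P κ N (i + 1) h x := rfl
  rw [gadj, this]
  exact mem_union_right _ (mem_image_of_mem _ (mem_univ e))

lemma gadj_O {k d d' : ℕ} (P : GP k d d') (κ N : ℕ) (y : Fin N) (r : Fin 65) :
    gadj P κ N (uN κ le_rfl ⟨(65 * y.val + r.val) % 2 ^ κ, Nat.mod_lt _ (by positivity)⟩) (oN y) := by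
  have : gpar P κ N (oN y) = opar y := rfl
  rw [gadj, this]
  exact mem_image_of_mem _ (mem_univ r)

lemma gpar_card {k d d' : ℕ} (P : GP k d d') (κ N : ℕ) (v : GNode k κ N) :
    (gpar P κ N v).card ≤ d + d' + 65 := by
  match v with
  | Sum.inl x => exact card_image_le.trans ((dpar_card _ _ _ _ _).trans (by omega))
  | Sum.inr (Sum.inl ⟨i, x⟩) =>
    simp only [gpar, vpar]
    split_ifs
    · refine card_image_le.trans ?_
      simp
    · refine card_image_le.trans ?_
      simp; omega
  | Sum.inr (Sum.inr (Sum.inl ⟨⟨i, hi⟩, x⟩)) =>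
    simp only [gpar]
    cases i with
    | zero =>
      refine card_image_le.trans ?_
      simp
    | succ i =>
      refine (card_union_le _ _).trans ((Nat.add_le_add card_image_le card_image_le).trans ?_)
      simp
  | Sum.inr (Sum.inr (Sum.inr y)) =>
    simp only [gpar, opar]
    refine card_image_le.trans ?_
    simp

def grank {k κ N : ℕ} : GNode k κ N → ℕ
  | Sum.inl x => drank k x
  | Sum.inr (Sum.inl ⟨i, _⟩) => 2 * 2 ^ k + (κ - i.val)
  | Sum.inr (Sum.inr (Sum.inl ⟨i, _⟩)) => 2 * 2 ^ k + κ + 1 + i.val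
  | Sum.inr (Sum.inr (Sum.inr _)) => 2 * 2 ^ k + κ + 1 + κ + 1

lemma drank_lt (k : ℕ) (x : DN k) : drank k x < 2 * 2 ^ k := by
  have := x.1.isLt
  unfold drank
  split_ifs <;> omega

lemma grank_d {k κ N : ℕ} (x : DN k) : grank (dN x : GNode k κ N) = drank k x := rfl
lemma grank_v {k κ N : ℕ} (i : ℕ) (h : i ≤ κ) (x : Fin (2 ^ i)) :
    grank (vN i h x : GNode k κ N) = 2 * 2 ^ k + (κ - i) := rfl
lemma grank_u {k κ N : ℕ} (i : ℕ) (h : i ≤ κ) (x : Fin (2 ^ i)) :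
    grank (uN i h x : GNode k κ N) = 2 * 2 ^ k + κ + 1 + i := rfl

lemma gadj_rank {k d d' : ℕ} (P : GP k d d') (κ N : ℕ) (u v : GNode k κ N) (h : gadj P κ N u v) :
    grank u < grank v := by
  unfold gadj at h
  match v with
  | Sum.inl x =>
    simp only [gpar, mem_image] at h
    obtain ⟨y, hy, rfl⟩ := h
    exact dpar_rank _ _ _ _ _ _ hy
  | Sum.inr (Sum.inl ⟨i, x⟩) =>
    simp only [gpar, vpar] at h
    split_ifs at h with hi
    · simp only [mem_image, mem_univ, true_and] at h
      obtain ⟨e, rfl⟩ := h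
      rw [grank_v]
      simp only [grank]
      omega
    · simp only [mem_image, mem_univ, true_and] at h
      obtain ⟨e, rfl⟩ := h
      rw [grank_d]
      have := drank_lt k (P.eDV i.val x e)
      simp only [grank]
      omega
  | Sum.inr (Sum.inr (Sum.inl ⟨⟨i, hi⟩, x⟩)) =>
    simp only [gpar] at h
    cases i with
    | zero =>
      simp only [upar, mem_image, mem_univ, true_and] at h
      obtain ⟨e, rfl⟩ := h
      rw [grank_v]
      simp only [grank]
      omega
    | succ i =>
      simp only [upar, mem_union, mem_image, mem_univ, true_and] at h
      rcases h with ⟨e, rfl⟩ | ⟨e, rfl⟩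
      · rw [grank_v]
        simp only [grank]
        omega
      · rw [grank_u]
        simp only [grank]
        omega
  | Sum.inr (Sum.inr (Sum.inr y)) =>
    simp only [gpar, opar, mem_image, mem_univ, true_and] at h
    obtain ⟨e, rfl⟩ := h
    rw [grank_u]
    simp only [grank]
    omega

lemma gadj_acyclic {k d d' : ℕ} (P : GP k d d') (κ N : ℕ) : Acyclic (gadj P κ N) := by
  have key : ∀ u v, Relation.TransGen (gadj P κ N) u v → grank u < grank v := by
    intro u v h
    induction h with
    | single h => exact gadj_rank P κ N _ _ h
    | tail _ h ih => exact ih.trans (gadj_rank P κ N _ _ h)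
  intro v h
  exact lt_irrefl _ (key v v h)

lemma gadj_indeg {k d d' : ℕ} (P : GP k d d') (κ N : ℕ) (v : GNode k κ N) :
    indeg (gadj P κ N) v ≤ d + d' + 65 := by
  have : indeg (gadj P κ N) v = (gpar P κ N v).card := by
    unfold indeg gadj
    simp
  rw [this]
  exact gpar_card P κ N v

lemma gnode_card (k κ N : ℕ) : Nat.card (GNode k κ N) ≤ 2 * k * 2 ^ k + 2 * 2 ^ (κ + 1) + N := by
  have h : ∑ i : Fin (κ + 1), 2 ^ i.val ≤ 2 ^ (κ + 1) := by
    rw [Fin.sum_univ_eq_sum_range (fun i => 2 ^ i)]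
    have := Nat.geomSum_lt (m := 2) (n := κ + 1) (s := range (κ + 1)) le_rfl (by simp)
    exact this.le
  simp only [Nat.card_eq_fintype_card, Fintype.card_sum, Fintype.card_prod, Fintype.card_sigma,
    Fintype.card_fin, Fintype.card_bool]
  nlinarith


lemma vN_inj {k κ N i : ℕ} (h : i ≤ κ) : Function.Injective (vN (k := k) (N := N) i h) := by
  intro x y hxy
  simpa [vN] using hxy

lemma uN_inj {k κ N i : ℕ} (h : i ≤ κ) : Function.Injective (uN (k := k) (N := N) i h) := by
  intro x y hxy
  simpa [uN] using hxy

lemma dN_inj {k κ N : ℕ} : Function.Injective (dN (k := k) (κ := κ) (N := N)) := by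
  intro x y hxy
  simpa [dN] using hxy

lemma oN_inj {k κ N : ℕ} : Function.Injective (oN (k := k) (κ := κ) (N := N)) := by
  intro x y hxy
  simpa [oN] using hxy

lemma hard_core {k d d' : ℕ} (P : GP k d d') (κ N t : ℕ) (c : ℝ) (hc0 : 0 < c) (hc : c ≤ 1 / 65)
    (hVV : ∀ i (Y : Finset (Fin (2 ^ i))) (T : Finset (Fin (2 ^ (i + 1)))), (∀ y ∈ Y, ∀ e, P.eVV i y e ∈ T) → 2 ^ i ≤ 8 * T.card ∨ 4 * Y.card ≤ T.card)
    (hVU : ∀ i (Y : Finset (Fin (2 ^ i))) (T : Finset (Fin (2 ^ i))), (∀ y ∈ Y, ∀ e, P.eVU i y e ∈ T) → 2 ^ i ≤ 8 * T.card ∨ 4 * Y.card ≤ T.card)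
    (hUU : ∀ i (Y : Finset (Fin (2 ^ (i + 1)))) (T : Finset (Fin (2 ^ i))), (∀ y ∈ Y, ∀ e, P.eUU i y e ∈ T) →
      2 ^ (i + 1) ≤ 8 * T.card ∨ 4 * Y.card ≤ T.card)
    (hDV : ∀ (Y : Finset (Fin (2 ^ κ))) (X : Finset (DN k)), c / 4 * 2 ^ κ ≤ Y.card →
      c / 4 * (2 * k * 2 ^ k) ≤ X.card → ∃ y ∈ Y, ∃ e, P.eDV κ y e ∈ X)
    (hD : ∀ (Dead : Finset (DN k)) (lam : DN k → ℕ), (∀ x, x ∉ Dead → lam x < t) →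
      (∀ x y, x ∈ dpar k d P.gad P.nb y → x ∉ Dead → y ∉ Dead → lam x < lam y) →
      c * k * 2 ^ k < (Dead.card : ℝ))
    (hN : (N : ℝ) ≤ c / 2 * (k * 2 ^ k)) (hκ : (2 * k * 2 ^ k : ℝ) ≤ 2 ^ κ)
    (S : Finset (GNode k κ N)) (hS : S.card ≤ N) [DecidablePred (fun y : Fin N => ¬ Dp (gadj P κ N) S t (oN y))] :
    (univ.filter (fun y : Fin N => ¬ Dp (gadj P κ N) S t (oN y))).card ≤ S.card := by
  classical
  set A := gadj P κ N with hA
  have hSN : (S.card : ℝ) ≤ N := by exact_mod_cast hS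
  -- deep nodes in the first part
  have hdeep : c / 4 * (2 * k * 2 ^ k) ≤ ((univ.filter (fun x : DN k => Dp A S t (dN x))).card : ℝ) := by
    have h1 := hD (univ.filter (fun x : DN k => (dN x : GNode k κ N) ∈ S ∨ Dp A S t (dN x)))
      (fun x => lamD A S t (dN x))
      (by
        intro x hx
        simp only [mem_filter, mem_univ, true_and, not_or] at hx
        exact lamD_lt hx.1 hx.2)
      (by
        intro x y hxy hx hy
        simp only [mem_filter, mem_univ, true_and, not_or] at hx hy
        exact lamD_inc hx.1 hx.2 hy.1 (gadj_D P κ N x y hxy))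
    rw [filter_or] at h1
    have h2 := card_union_le (univ.filter (fun x : DN k => (dN x : GNode k κ N) ∈ S))
      (univ.filter (fun x : DN k => Dp A S t (dN x)))
    have h3 : (univ.filter (fun x : DN k => (dN x : GNode k κ N) ∈ S)).card ≤ S.card := by
      apply card_le_card_of_injOn dN
      · intro x hx; simpa using hx
      · exact dN_inj.injOn
    have h4 : (((univ.filter (fun x : DN k => (dN x : GNode k κ N) ∈ S)) ∪
      (univ.filter (fun x : DN k => Dp A S t (dN x)))).card : ℝ) ≤ S.card +
        (univ.filter (fun x : DN k => Dp A S t (dN x))).card := by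
      exact_mod_cast h2.trans (by omega)
    linarith
  let X : ∀ i, Finset (Fin (2 ^ i)) := fun i => univ.filter (fun x => ∃ h : i ≤ κ, ¬ Dp A S t (vN i h x))
  let SV : ∀ i, Finset (Fin (2 ^ i)) := fun i => univ.filter (fun x => ∃ h : i ≤ κ, (vN i h x : GNode k κ N) ∈ S)
  let B : ∀ i, Finset (Fin (2 ^ i)) := fun i => univ.filter (fun x => ∃ h : i ≤ κ, ¬ Dp A S t (uN i h x))
  let SU : ∀ i, Finset (Fin (2 ^ i)) := fun i => univ.filter (fun x => ∃ h : i ≤ κ, (uN i h x : GNode k κ N) ∈ S)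
  let O : Finset (GNode k κ N) := univ.image oN
  let σ := (S \ O).card
  have hσ : σ ≤ S.card := card_le_card sdiff_subset
  have hSV : ∀ i ≤ κ, (SV i).card ≤ σ := by
    intro i hi
    apply card_le_card_of_injOn (vN i hi)
    · intro x hx
      simp only [SV, coe_filter, mem_univ, true_and, Set.mem_ofPred_eq] at hx
      obtain ⟨_, hx⟩ := hx
      simp only [O, coe_sdiff, Set.mem_sdiff, mem_coe]
      refine ⟨hx, ?_⟩
      simp [vN, oN]
    · exact (vN_inj hi).injOn
  have hSU : ∀ i ≤ κ, (SU i).card ≤ σ := by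
    intro i hi
    apply card_le_card_of_injOn (uN i hi)
    · intro x hx
      simp only [SU, coe_filter, mem_univ, true_and, Set.mem_ofPred_eq] at hx
      obtain ⟨_, hx⟩ := hx
      simp only [O, coe_sdiff, Set.mem_sdiff, mem_coe]
      refine ⟨hx, ?_⟩
      simp [uN, oN]
    · exact (uN_inj hi).injOn
  have htop : 32 * (X κ).card ≤ 2 ^ κ := by
    have h1 : ((X κ \ SV κ).card : ℝ) < c / 4 * 2 ^ κ := by
      by_contra hcon
      push Not at hcon
      obtain ⟨y, hy, e, he⟩ := hDV _ _ hcon hdeep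
      simp only [X, SV, mem_sdiff, mem_filter, mem_univ, true_and, not_exists] at hy he
      obtain ⟨⟨_, hy1⟩, hy2⟩ := hy
      exact hy1 (Dp_step (hy2 le_rfl) he (gadj_DV P κ N y e))
    have h2 : (X κ).card ≤ (X κ \ SV κ).card + S.card := by
      have h3 : (X κ).card ≤ (X κ \ SV κ).card + (SV κ).card := by
        rw [← card_union_of_disjoint sdiff_disjoint]
        apply card_le_card
        intro x hx
        by_cases h : x ∈ SV κ <;> simp [h, hx]
      have := hSV κ le_rfl
      omega
    have h3 : ((X κ).card : ℝ) ≤ (X κ \ SV κ).card + S.card := by exact_mod_cast h2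
    have h5 : (0:ℝ) < 2 ^ κ := by positivity
    have h4 : (32 * (X κ).card : ℝ) ≤ 2 ^ κ := by nlinarith
    exact_mod_cast h4
  have hchain := chain_lemma κ σ P.eVV P.eVU P.eUU hVV hVU hUU X SV B SU hSV hSU
    (by
      intro i hi x hx hxS e
      simp only [X, SV, mem_filter, mem_univ, true_and, not_exists] at hx hxS ⊢
      obtain ⟨_, hx⟩ := hx
      exact ⟨hi, fun hd => hx (Dp_step (hxS hi.le) hd (gadj_VV P κ N i hi x e))⟩)
    (by
      intro i hi x hx hxS e
      simp only [X, B, SU, mem_filter, mem_univ, true_and, not_exists] at hx hxS ⊢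
      obtain ⟨_, hx⟩ := hx
      exact ⟨hi, fun hd => hx (Dp_step (hxS hi) hd (gadj_VU P κ N i hi x e))⟩)
    (by
      intro i hi x hx hxS e
      simp only [B, SU, mem_filter, mem_univ, true_and, not_exists] at hx hxS ⊢
      obtain ⟨_, hx⟩ := hx
      exact ⟨hi.le, fun hd => hx (Dp_step (hxS hi) hd (gadj_UU P κ N i hi x e))⟩)
    htop
  have h65 : 65 * N ≤ 2 ^ κ := by
    have h5 : (0:ℝ) < 2 ^ κ := by positivity
    have : (65 * N : ℝ) ≤ 2 ^ κ := by nlinarith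
    exact_mod_cast this
  let Y := univ.filter (fun y : Fin N => ¬ Dp A S t (oN y) ∧ (oN y : GNode k κ N) ∉ S)
  have hY : Y.card * 65 ≤ (B κ).card := by
    have : (Y ×ˢ (univ : Finset (Fin 65))).card ≤ (B κ).card := by
      apply card_le_card_of_injOn (fun p : Fin N × Fin 65 =>
        (⟨(65 * p.1.val + p.2.val) % 2 ^ κ, Nat.mod_lt _ (by positivity)⟩ : Fin (2 ^ κ)))
      · rintro ⟨y, r⟩ hy
        simp only [Y, coe_product, coe_filter, mem_univ, true_and, coe_univ, Set.mem_prod,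
          Set.mem_ofPred_eq, Set.mem_univ, and_true] at hy
        simp only [B, coe_filter, mem_univ, true_and, Set.mem_ofPred_eq]
        exact ⟨le_rfl, fun hd => hy.1 (Dp_step hy.2 hd (gadj_O P κ N y r))⟩
      · rintro ⟨y, r⟩ _ ⟨y', r'⟩ _ h
        simp only [Fin.mk.injEq] at h
        have := y.isLt
        have := y'.isLt
        have := r.isLt
        have := r'.isLt
        rw [Nat.mod_eq_of_lt (by omega), Nat.mod_eq_of_lt (by omega)] at h
        ext
        · simp only; omega
        · simp only; omega
    simpa [card_product] using this
  have hY2 : Y.card ≤ σ := by omega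
  have hO : (univ.filter (fun y : Fin N => (oN y : GNode k κ N) ∈ S)).card ≤ (S ∩ O).card := by
    apply card_le_card_of_injOn oN
    · intro x hx
      simp only [coe_filter, mem_univ, true_and, Set.mem_ofPred_eq] at hx
      simp [O, hx]
    · exact oN_inj.injOn
  have hfin : univ.filter (fun y : Fin N => ¬ Dp A S t (oN y)) ⊆
      Y ∪ univ.filter (fun y : Fin N => (oN y : GNode k κ N) ∈ S) := by
    intro y hy
    simp only [mem_filter, mem_univ, true_and] at hy
    simp only [Y, mem_union, mem_filter, mem_univ, true_and, hy, not_false_eq_true]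
    tauto
  have h1 := (card_le_card hfin).trans (card_union_le _ _)
  have h2 : (S \ O).card + (S ∩ O).card = S.card := card_sdiff_add_card_inter S O
  have h3 : σ = (S \ O).card := rfl
  have h5 := h1.trans (show Y.card + (univ.filter (fun y : Fin N => (oN y : GNode k κ N) ∈ S)).card ≤ S.card by omega)
  exact le_trans (le_of_eq (by congr)) h5

lemma hard_of_core {k d d' : ℕ} (P : GP k d d') (κ N t s : ℕ) (hN0 : 1 ≤ N) (hs : s ≤ N)
    (h : ∀ (S : Finset (GNode k κ N)), S.card ≤ N →
      ∀ [DecidablePred (fun y : Fin N => ¬ Dp (gadj P κ N) S t (oN y))],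
      (univ.filter (fun y : Fin N => ¬ Dp (gadj P κ N) S t (oN y))).card ≤ S.card) :
    Hard (gadj P κ N) (univ.image oN) s t ((s : ℝ) / (N : ℝ)) := by
  classical
  intro S hS
  have h1 := h S (hS.trans hs)
  have hc : ((univ : Finset (Fin N)).image (oN : Fin N → GNode k κ N)).card = N := by
    rw [card_image_of_injective _ oN_inj]; simp
  have h2 : (univ.filter (fun y : Fin N => Dp (gadj P κ N) S t (oN y))).card ≤
      Set.ncard {v | v ∈ ((univ : Finset (Fin N)).image (oN : Fin N → GNode k κ N)) ∧
        ∃ p : List (GNode k κ N), PathIn (gadj P κ N) p ∧ (∀ x ∈ p, x ∉ S) ∧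
        p.getLast? = some v ∧ t + 1 ≤ p.length} := by
    rw [← card_image_of_injective _ (oN_inj (k := k) (κ := κ) (N := N)), ← Set.ncard_coe_finset]
    apply Set.ncard_le_ncard _ (Set.toFinite _)
    intro v hv
    simp only [coe_image, coe_filter, mem_univ, true_and] at hv
    obtain ⟨y, hy, rfl⟩ := hv
    exact ⟨mem_image_of_mem _ (mem_univ y), hy⟩
  have h3 := card_filter_add_card_filter_not (s := (univ : Finset (Fin N))) (fun y : Fin N => Dp (gadj P κ N) S t (oN y))
  rw [card_univ, Fintype.card_fin] at h3
  have h4 : N ≤ (univ.filter (fun y : Fin N => Dp (gadj P κ N) S t (oN y))).card + s := by omega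
  rw [hc]
  have h5 : (N : ℝ) ≠ 0 := by positivity
  have h6 : (1 - (s : ℝ) / N) * N = N - s := by field_simp
  rw [h6]
  refine le_trans ?_ (Nat.cast_le.mpr h2)
  have := (Nat.cast_le (α := ℝ)).mpr h4
  push_cast at this
  linarith


lemma num_bound (ε : ℝ) (hε : 0 < ε) : ∃ (η : ℝ) (k0 : ℕ), 0 < η ∧ 2 ≤ k0 ∧ ∀ k ≥ k0, ∀ N : ℕ, 1 ≤ N →
    (N : ℝ) ≤ k * 2 ^ k →
    (⌊(N : ℝ) ^ ((1 : ℝ) - ε)⌋₊ : ℝ) + 1 < 2 ^ k * Real.exp (-(η * k)) := by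
  set ε' := min ε 1 with he'
  have h0 : 0 < ε' := by positivity
  have h1 : ε' ≤ 1 := min_le_right _ _
  have h2 : ε' ≤ ε := min_le_left _ _
  set L := Real.log 2 with hL
  have hLp : 0 < L := Real.log_pos (by norm_num)
  set b := ε' * L / 2 with hb
  have hbp : 0 < b := by positivity
  obtain ⟨k1, hk1⟩ := exists_nat_ge (2 / b ^ 2)
  refine ⟨b, max 2 k1, hbp, le_max_left _ _, ?_⟩
  intro k hk N hN hNk
  have hk2 : 2 ≤ k := (le_max_left _ _).trans hk
  have hkk : (k1 : ℝ) ≤ k := by exact_mod_cast (le_max_right _ _).trans hk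
  have hk3 : (2 : ℝ) ≤ k := by exact_mod_cast hk2
  have hN1 : (1 : ℝ) ≤ N := by exact_mod_cast hN
  have hexp : (k : ℝ) + 1 < Real.exp (b * k) := by
    have q := Real.quadratic_le_exp_of_nonneg (show 0 ≤ b * k by positivity)
    have q2 : 2 / b ^ 2 ≤ (k : ℝ) := hk1.trans hkk
    rw [div_le_iff₀ (by positivity)] at q2
    have q3 : 0 < b * k := by positivity
    nlinarith
  have h2k : (2 : ℝ) ^ k = Real.exp (L * k) := by
    rw [mul_comm, Real.exp_nat_mul, hL, Real.exp_log (by norm_num)]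
  have ht : (⌊(N : ℝ) ^ ((1 : ℝ) - ε)⌋₊ : ℝ) ≤ k * Real.exp (L * (1 - ε') * k) := by
    calc (⌊(N : ℝ) ^ ((1 : ℝ) - ε)⌋₊ : ℝ) ≤ (N : ℝ) ^ ((1 : ℝ) - ε) := Nat.floor_le (by positivity)
      _ ≤ (N : ℝ) ^ ((1 : ℝ) - ε') := Real.rpow_le_rpow_of_exponent_le hN1 (by linarith)
      _ ≤ (k * 2 ^ k : ℝ) ^ ((1 : ℝ) - ε') := Real.rpow_le_rpow (by positivity) hNk (by linarith)
      _ = (k : ℝ) ^ ((1 : ℝ) - ε') * ((2 : ℝ) ^ k) ^ ((1 : ℝ) - ε') :=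
          Real.mul_rpow (by positivity) (by positivity)
      _ ≤ (k : ℝ) ^ (1 : ℝ) * ((2 : ℝ) ^ k) ^ ((1 : ℝ) - ε') := by
          apply mul_le_mul_of_nonneg_right _ (by positivity)
          exact Real.rpow_le_rpow_of_exponent_le (by linarith) (by linarith)
      _ = _ := by
          rw [Real.rpow_one, h2k, ← Real.exp_mul]
          congr 2; ring
  have hE : (2 : ℝ) ^ k * Real.exp (-(b * k)) = Real.exp (L * (1 - ε') * k) * Real.exp (b * k) := by
    rw [h2k, ← Real.exp_add, ← Real.exp_add]
    congr 1
    rw [hb]; ring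
  rw [hE]
  have hge : 1 ≤ Real.exp (L * (1 - ε') * k) := by
    apply Real.one_le_exp
    have : 0 ≤ 1 - ε' := by linarith
    positivity
  nlinarith

lemma choose_k (c : ℝ) (hc : 0 < c) (k0 : ℕ) (hk0 : 2 ≤ k0) (N : ℕ) (hN : 1 ≤ N) :
    ∃ k ≥ k0, (N : ℝ) ≤ c / 2 * (k * 2 ^ k) ∧
      (k * 2 ^ k : ℝ) ≤ (k0 * 2 ^ k0 + 8 / c) * N := by
  classical
  have hN1 : (1 : ℝ) ≤ N := by exact_mod_cast hN
  have hex : ∃ k, k0 ≤ k ∧ (N : ℝ) ≤ c / 2 * (k * 2 ^ k) := by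
    obtain ⟨m, hm⟩ := exists_nat_ge (2 * N / c)
    refine ⟨max k0 m, le_max_left _ _, ?_⟩
    have h1 : (m : ℝ) ≤ (max k0 m : ℕ) := by exact_mod_cast le_max_right _ _
    have h2 : (1 : ℝ) ≤ 2 ^ (max k0 m) := one_le_pow₀ (by norm_num)
    have h3 : 2 * N / c ≤ ((max k0 m : ℕ) : ℝ) * 2 ^ (max k0 m) := by
      have : (0 : ℝ) ≤ (max k0 m : ℕ) := by positivity
      nlinarith
    rw [div_le_iff₀ hc] at h3
    linarith
  obtain ⟨h1, h2⟩ := Nat.find_spec hex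
  refine ⟨Nat.find hex, h1, h2, ?_⟩
  have hmin := fun m => Nat.find_min hex (m := m)
  set k := Nat.find hex with hk
  rcases h1.eq_or_lt with h | h
  · rw [← h]
    have : (0 : ℝ) ≤ 8 / c := by positivity
    have : (0 : ℝ) ≤ k0 * 2 ^ k0 := by positivity
    nlinarith
  · obtain ⟨m, hm⟩ : ∃ m, k = m + 1 := ⟨k - 1, by omega⟩
    have h3 := hmin m (by omega)
    push Not at h3
    have h4 := h3 (by omega)
    have h5 : (1 : ℝ) ≤ m := by exact_mod_cast (show 1 ≤ m by omega)
    have h6 : (0 : ℝ) < 2 ^ m := by positivity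
    have h7 : (k * 2 ^ k : ℝ) ≤ 4 * (m * 2 ^ m) := by
      rw [hm, pow_succ]; push_cast; nlinarith
    have h8 : (m * 2 ^ m : ℝ) ≤ 2 / c * N := by
      rw [div_mul_eq_mul_div, le_div_iff₀ hc]; linarith
    have h9 : (0 : ℝ) ≤ k0 * 2 ^ k0 * N := by positivity
    have : 8 / c * N = 4 * (2 / c * N) := by ring
    linarith

lemma main_aux (ε : ℝ) (hε : 0 < ε) :
    ∃ (c : ℝ) (cind : ℕ), 0 < c ∧
      ∀ N : ℕ, 1 ≤ N → ∃ (G : Dig) (VC : Finset G.V),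
        Acyclic G.Adj ∧
        ((Nat.card G.V : ℝ) ≤ c * N) ∧
        (∀ x : G.V, indeg G.Adj x ≤ cind) ∧
        VC.card = N ∧
        ∀ s ≤ N, Hard G.Adj VC s ⌊(N : ℝ) ^ ((1 : ℝ) - ε)⌋₊
          ((s : ℝ) / (N : ℝ)) := by
  classical
  obtain ⟨η, k0, hη, hk0, hnum⟩ := num_bound ε hε
  obtain ⟨c, d, hc0, hc, hD⟩ := D_thm η hη
  obtain ⟨d', hd'⟩ := disperser (c / 4) (by positivity)
  refine ⟨18 * (k0 * 2 ^ k0 + 8 / c) + 1, d + d' + 65, by positivity, ?_⟩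
  intro N hN
  obtain ⟨k, hk, hNk, hkN⟩ := choose_k c hc0 k0 hk0 N hN
  have hkpos : 0 < k := by omega
  obtain ⟨gad, nb, hgn⟩ := hD k hkpos
  have hVV := fun i => expander (2 ^ i) (2 ^ (i + 1)) (by positivity) (by rw [pow_succ]; omega)
  have hVU := fun i => expander (2 ^ i) (2 ^ i) (by positivity) (by omega)
  have hUU := fun i => expander (2 ^ (i + 1)) (2 ^ i) (by positivity) (by rw [pow_succ]; omega)
  choose eVV hVV using hVV
  choose eVU hVU using hVU
  choose eUU hUU using hUU
  have hcardD : Fintype.card (DN k) = 2 * k * 2 ^ k := by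
    simp only [Fintype.card_prod, Fintype.card_fin, Fintype.card_bool]; ring
  have hp : 0 < 2 * k * 2 ^ k := by positivity
  have hDV : ∀ i, ∃ e : Fin (2 ^ i) → Fin d' → DN k, 2 * k * 2 ^ k ≤ 2 ^ i →
      ∀ (Y : Finset (Fin (2 ^ i))) (X : Finset (DN k)), c / 4 * 2 ^ i ≤ Y.card →
      c / 4 * (2 * k * 2 ^ k) ≤ X.card → ∃ y ∈ Y, ∃ f, e y f ∈ X := by
    intro i
    by_cases h : 2 * k * 2 ^ k ≤ 2 ^ i
    · obtain ⟨e, he⟩ := hd' (Fin (2 ^ i)) (DN k) (by simp) (by rw [hcardD]; exact hp)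
        (by rw [hcardD]; simpa using h)
      refine ⟨e, fun _ Y X hY hX => he Y X ?_ ?_⟩
      · simpa using hY
      · rw [hcardD]; push_cast; exact hX
    · exact ⟨fun _ _ => (⟨0, by positivity⟩, ⟨0, hkpos⟩, true), fun h' => absurd h' h⟩
  choose eDV hDV using hDV
  let P : GP k d d' := ⟨gad, nb, eDV, eVV, eVU, eUU⟩
  set κ := Nat.clog 2 (2 * k * 2 ^ k) with hκ
  have hκ1 : 2 * k * 2 ^ k ≤ 2 ^ κ := Nat.le_pow_clog (by norm_num) _
  have hκ2 : 2 ^ κ ≤ 4 * k * 2 ^ k := by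
    have h1 : 1 < 2 * k * 2 ^ k := by
      have : 1 ≤ 2 ^ k := Nat.one_le_two_pow
      nlinarith
    have h2 := Nat.pow_pred_clog_lt_self (b := 2) (by norm_num) h1
    have h3 : 0 < κ := Nat.clog_pos (by norm_num) h1
    rw [← hκ] at h2
    obtain ⟨m, hm⟩ : ∃ m, κ = m + 1 := ⟨κ - 1, by omega⟩
    rw [hm] at h2 ⊢
    simp only [Nat.pred_eq_sub_one, Nat.add_sub_cancel] at h2
    rw [pow_succ]
    nlinarith
  have hκ1' : (2 * k * 2 ^ k : ℝ) ≤ 2 ^ κ := by exact_mod_cast hκ1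
  have hNk2 : (N : ℝ) ≤ k * 2 ^ k := by
    have : (0 : ℝ) ≤ k * 2 ^ k := by positivity
    nlinarith
  have hlt := hnum k hk N hN hNk2
  refine ⟨{ V := GNode k κ N, Adj := gadj P κ N }, univ.image oN, gadj_acyclic P κ N, ?_,
    gadj_indeg P κ N, ?_, ?_⟩
  · have h1 := gnode_card k κ N
    have h2 : Nat.card (GNode k κ N) ≤ 18 * (k * 2 ^ k) + N := by
      rw [pow_succ] at h1; nlinarith
    have h3 : (Nat.card (GNode k κ N) : ℝ) ≤ 18 * (k * 2 ^ k) + N := by exact_mod_cast h2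
    refine h3.trans ?_
    nlinarith
  · rw [card_image_of_injective _ oN_inj]; simp
  · intro s hs
    apply hard_of_core P κ N _ s hN hs
    intro S hS _
    refine hard_core P κ N _ c hc0 hc hVV hVU hUU (hDV κ hκ1) ?_ hNk hκ1' S hS
    intro Dead lam h1 h2
    by_contra hcon
    push Not at hcon
    have := hgn Dead lam _ h1 h2 hcon
    linarith

end Helpers

/-- For every constant `ε > 0` there are a constant `c > 0`,
a family of constant-indegree DAGs `{G_N}` with at most `c·N` nodes, and target
sets `V_C ⊆ V(G_N)` of size `N`, such that `(G_N, V_C)` is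
`(s, N^{1−ε}, s/N)`-hard for every `s ≤ N`. -/
theorem exists_tight_proof_of_space_family (ε : ℝ) (hε : 0 < ε) :
    ∃ (c : ℝ) (cind : ℕ), 0 < c ∧
      ∃ (G : ℕ → Dig) (VC : (N : ℕ) → Finset (G N).V), ∀ N, 1 ≤ N →
        Acyclic (G N).Adj ∧
        ((Nat.card (G N).V : ℝ) ≤ c * N) ∧
        (∀ x : (G N).V, indeg (G N).Adj x ≤ cind) ∧
        (VC N).card = N ∧
        ∀ s ≤ N, Hard (G N).Adj (VC N) s ⌊(N : ℝ) ^ ((1 : ℝ) - ε)⌋₊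
          ((s : ℝ) / (N : ℝ)) := by
  obtain ⟨c, cind, hc, h⟩ := main_aux ε hε
  refine ⟨c, cind, hc, ?_⟩
  have h2 : ∀ N : ℕ, ∃ (G : Dig) (VC : Finset G.V), 1 ≤ N →
        Acyclic G.Adj ∧
        ((Nat.card G.V : ℝ) ≤ c * N) ∧
        (∀ x : G.V, indeg G.Adj x ≤ cind) ∧
        VC.card = N ∧
        ∀ s ≤ N, Hard G.Adj VC s ⌊(N : ℝ) ^ ((1 : ℝ) - ε)⌋₊
          ((s : ℝ) / (N : ℝ)) := by
    intro N
    by_cases hN : 1 ≤ N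
    · obtain ⟨G, VC, hG⟩ := h N hN
      exact ⟨G, VC, fun _ => hG⟩
    · exact ⟨{ V := Unit, Adj := fun _ _ => False }, ∅, fun h1 => absurd h1 hN⟩
  choose G VC hG using h2
  exact ⟨G, VC, hG⟩
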